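/- Let p and q be distinct odd primes, n = pq, φ = (p−1)(q−1), and let r be a PRIME with r ∣ p−1, gcd(r, (p−1)/r) = 1 and gcd(r, q−1) = 1. Let y be an integer coprime to n, g a primitive root modulo p, and α an integer with y ≡ g^α (mod p). Then Benaloh's original condition y^{φ/r} ≢ 1 (mod n) is equivalent to gcd(α, r) = 1, and hence is equivalent to decryption working unambiguously: for all integers m₁, m₂ and all integers u₁, u₂ coprime to n, y^{m₁}·u₁^r ≡ y^{m₂}·u₂^r (mod n) implies m₁ ≡ m₂ (mod r). -/

import Mathlib

theorem Int.pow_modEq_pow_iff_of_generates {p : ℕ} (hp : p.Prime) (hpodd : Odd p) {g : ℤ}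
    (hg : ∀ z : ℤ, IsCoprime z (p : ℤ) → ∃ k : ℕ, z ≡ g ^ k [ZMOD (p : ℤ)]) (a b : ℕ) :
    g ^ a ≡ g ^ b [ZMOD (p : ℤ)] ↔ a ≡ b [MOD p - 1] := by
  have : Fact p.Prime := ⟨hp⟩
  have : Fact (2 < p) := ⟨by
    have := hp.two_le
    obtain ⟨k, hk⟩ := hpodd
    omega⟩
  have hpow (x : (ZMod p)ˣ) : ∃ k : ℕ, (x : ZMod p) = (g : ZMod p) ^ k := by
    obtain ⟨z, hz⟩ := ZMod.intCast_surjective (x : ZMod p)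
    have hzu : IsUnit (z : ZMod p) := hz ▸ x.isUnit
    rw [ZMod.coe_int_isUnit_iff_isCoprime] at hzu
    obtain ⟨k, hk⟩ := hg z hzu.symm
    rw [← ZMod.intCast_eq_intCast_iff] at hk
    exact ⟨k, by rw [← hz, hk]; push_cast; rfl⟩
  have hg0 : (g : ZMod p) ≠ 0 := by
    intro h0
    obtain ⟨k, hk⟩ := hpow (-1)
    rcases Nat.eq_zero_or_pos k with rfl | hk0
    · exact ZMod.neg_one_ne_one (n := p) (by simpa using hk)
    · rw [h0, zero_pow hk0.ne'] at hk
      exact (-1 : (ZMod p)ˣ).ne_zero hk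
  have hord : orderOf (Units.mk0 (g : ZMod p) hg0) = p - 1 := by
    rw [orderOf_eq_card_of_forall_mem_zpowers, Nat.card_eq_fintype_card, ZMod.card_units]
    intro x
    obtain ⟨k, hk⟩ := hpow x
    exact ⟨k, Units.ext (by simp [hk])⟩
  rw [← hord, ← pow_eq_pow_iff_modEq, ← ZMod.intCast_eq_intCast_iff, Units.ext_iff]
  simp

/-- An exponent coprime to `q - 1` makes every residue coprime to `q` a power. -/
theorem Int.exists_pow_modEq_of_coprime {q r : ℕ} (hq : q.Prime) (hr : r.Coprime (q - 1)) {y : ℤ}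
    (hy : IsCoprime y (q : ℤ)) : ∃ v : ℤ, v ^ r ≡ y [ZMOD (q : ℤ)] := by
  have : Fact q.Prime := ⟨hq⟩
  have hu : IsUnit (y : ZMod q) := (ZMod.coe_int_isUnit_iff_isCoprime y q).2 hy.symm
  have hcard : (Nat.card (ZMod q)ˣ).Coprime r := by
    rw [Nat.card_eq_fintype_card, ZMod.card_units]
    exact hr.symm
  obtain ⟨x, hx⟩ := (powCoprime hcard).surjective hu.unit
  obtain ⟨v, hv⟩ := ZMod.intCast_surjective (x : ZMod q)
  refine ⟨v, ?_⟩
  rw [← ZMod.intCast_eq_intCast_iff]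
  push_cast
  rw [hv, ← Units.val_pow_eq_pow_val]
  exact congrArg Units.val hx

theorem benaloh_prime_r_correct (p q n : ℕ) (hp : p.Prime) (hq : q.Prime)
    (hpodd : Odd p) (hqodd : Odd q) (hpq : p ≠ q)
    (hn : n = p * q) (φ : ℕ) (hφ : φ = (p - 1) * (q - 1)) (r : ℕ) (hrprime : r.Prime)
    (hrp : r ∣ p - 1) (hr1 : Nat.Coprime r ((p - 1) / r)) (hr2 : Nat.Coprime r (q - 1)) (y : ℤ) (hy : IsCoprime y (n : ℤ))
    (g : ℤ)
    (hg : ∀ z : ℤ, IsCoprime z (p : ℤ) → ∃ k : ℕ, z ≡ g ^ k [ZMOD (p : ℤ)])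
    (α : ℕ) (hα : y ≡ g ^ α [ZMOD (p : ℤ)]) :
    (¬ (y ^ (φ / r) ≡ 1 [ZMOD (n : ℤ)]) ↔ Nat.Coprime α r) ∧
    (¬ (y ^ (φ / r) ≡ 1 [ZMOD (n : ℤ)]) ↔
      (∀ (m₁ m₂ : ℕ) (u₁ u₂ : ℤ), IsCoprime u₁ (n : ℤ) → IsCoprime u₂ (n : ℤ) →
      y ^ m₁ * u₁ ^ r ≡ y ^ m₂ * u₂ ^ r [ZMOD (n : ℤ)] → m₁ ≡ m₂ [MOD r])) := by
  have hnz : (n : ℤ) = p * q := by rw [hn]; push_cast; rfl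
  have hcop : (p : ℤ).natAbs.Coprime (q : ℤ).natAbs := by
    simpa using (Nat.coprime_primes hp hq).2 hpq
  have hmod (a b : ℤ) : a ≡ b [ZMOD (n : ℤ)] ↔ a ≡ b [ZMOD (p : ℤ)] ∧ a ≡ b [ZMOD (q : ℤ)] := by
    rw [hnz, Int.modEq_and_modEq_iff_modEq_mul hcop]
  have hleft {u : ℤ} (hu : IsCoprime u (n : ℤ)) : IsCoprime u (p : ℤ) := by
    rw [hnz] at hu; exact hu.of_mul_right_left
  have hright {u : ℤ} (hu : IsCoprime u (n : ℤ)) : IsCoprime u (q : ℤ) := by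
    rw [hnz] at hu; exact hu.of_mul_right_right
  obtain ⟨e, he⟩ := hrp
  have hp1 : 0 < p - 1 := Nat.sub_pos_of_lt hp.one_lt
  have he0 : e ≠ 0 := by rintro rfl; simp at he; omega
  have hE : φ / r = e * (q - 1) := by
    rw [hφ, he, mul_assoc, Nat.mul_div_cancel_left _ hrprime.pos]
  have hkey (a b : ℕ) :
      (y ^ a) ^ (φ / r) ≡ (y ^ b) ^ (φ / r) [ZMOD (p : ℤ)] ↔ α * a ≡ α * b [MOD r] := by
    have h (c : ℕ) : (y ^ c) ^ (φ / r) ≡ g ^ (e * ((q - 1) * (α * c))) [ZMOD (p : ℤ)] := by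
      have h' := (hα.pow c).pow (φ / r)
      rwa [← pow_mul g, ← pow_mul g, show α * c * (φ / r) = e * ((q - 1) * (α * c)) by
        rw [hE]; ring] at h'
    have hiff := Int.pow_modEq_pow_iff_of_generates hp hpodd hg
      (e * ((q - 1) * (α * a))) (e * ((q - 1) * (α * b)))
    rw [he, mul_comm r e, Nat.ModEq.mul_left_cancel_iff' he0] at hiff
    refine ⟨fun H => Nat.ModEq.cancel_left_of_coprime hr2 (hiff.1 ((h a).symm.trans (H.trans (h b)))),
      fun H => (h a).trans ((hiff.2 (H.mul_left _)).trans (h b).symm)⟩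
  have hcond : y ^ (φ / r) ≡ 1 [ZMOD (n : ℤ)] ↔ r ∣ α := by
    have hyq : y ^ (φ / r) ≡ 1 [ZMOD (q : ℤ)] := by
      have := (Int.ModEq.pow_card_sub_one_eq_one hq (hright hy)).pow e
      rwa [← pow_mul, one_pow, mul_comm, ← hE] at this
    have := hkey 1 0
    rw [pow_one, pow_zero, one_pow, mul_one, mul_zero, Nat.modEq_zero_iff_dvd] at this
    rw [hmod, this]
    exact and_iff_left hyq
  have hαr : ¬ r ∣ α ↔ Nat.Coprime α r := by
    rw [Nat.coprime_comm, hrprime.coprime_iff_not_dvd]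
  rw [hcond, hαr]
  refine ⟨Iff.rfl, fun h m₁ m₂ u₁ u₂ hu₁ hu₂ H => ?_, fun H => hαr.1 ?_⟩
  · have hu {u : ℤ} (hu : IsCoprime u (n : ℤ)) : (u ^ r) ^ (φ / r) ≡ 1 [ZMOD (p : ℤ)] := by
      have := (Int.ModEq.pow_card_sub_one_eq_one hp (hleft hu)).pow (q - 1)
      rwa [← pow_mul, one_pow, he, mul_assoc, ← hE, pow_mul] at this
    have h1 (m : ℕ) {u : ℤ} (hc : IsCoprime u (n : ℤ)) :
        (y ^ m * u ^ r) ^ (φ / r) ≡ (y ^ m) ^ (φ / r) [ZMOD (p : ℤ)] := by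
      simpa [mul_pow] using (hu hc).mul_left ((y ^ m) ^ (φ / r))
    have h2 := ((h1 m₁ hu₁).symm.trans (((hmod _ _).1 H).1.pow (φ / r))).trans (h1 m₂ hu₂)
    exact Nat.ModEq.cancel_left_of_coprime h.symm ((hkey m₁ m₂).1 h2)
  · rintro ⟨k, rfl⟩
    obtain ⟨v, hv⟩ := Int.exists_pow_modEq_of_coprime hq hr2 (hright hy)
    obtain ⟨w, hwp, hwq⟩ : ∃ w : ℤ, w ≡ g ^ k [ZMOD (p : ℤ)] ∧ w ≡ v [ZMOD (q : ℤ)] := by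
      obtain ⟨s, t, hst⟩ := Int.isCoprime_iff_gcd_eq_one.2 hcop
      refine ⟨s * p * v + t * q * g ^ k, ?_, ?_⟩
      · exact Int.modEq_iff_dvd.2 ⟨s * (g ^ k - v), by linear_combination (-g ^ k) * hst⟩
      · exact Int.modEq_iff_dvd.2 ⟨t * (v - g ^ k), by linear_combination (-v) * hst⟩
    have hw : w ^ r ≡ y [ZMOD (n : ℤ)] := by
      refine (hmod _ _).2 ⟨(hwp.pow r).trans ?_, (hwq.pow r).trans hv⟩
      rw [← pow_mul, mul_comm]
      exact hα.symm
    have hwn : IsCoprime w (n : ℤ) := by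
      obtain ⟨c, hc⟩ := hw.dvd
      rw [sub_eq_iff_eq_add] at hc
      rw [hc, add_comm, IsCoprime.add_mul_left_left_iff] at hy
      exact (IsCoprime.pow_left_iff hrprime.pos).1 hy
    have := H 1 0 1 w isCoprime_one_left hwn (by simpa using hw.symm)
    exact hrprime.one_lt.ne' (Nat.dvd_one.1 ((Nat.modEq_zero_iff_dvd).1 this))
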